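/- arXiv:2010.03511 — 3 statements merged into one kernel-verified Lean document; each statement's English description precedes it below -/
import Mathlib

section
/- There exist a finite group G (namely ℤ/2ℤ), a globalizable partial action α of G on a commutative C*-algebra A, and a globalization (B, β) of α, such that dim_Rok(β) = 0 but α does not have Rokhlin dimension 0 (so dim_Rok(α) > 0). Concretely, one may take X = S¹∖{1}, U = X∖{−1}, γ the partial action of ℤ/2ℤ on C₀(X) induced by the map x ↦ −x from U to U, δ the flip action of ℤ/2ℤ on ℂ ⊕ ℂ, and α = γ ⊗ δ on A = C₀(X) ⊕ C₀(X); its globalization β on B = C(S¹) ⊕ C(S¹) has Rokhlin dimension 0, while dim_Rok(α) > 0. -/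
/-- A partial action of a (discrete) group `G` on a C*-algebra `A`: a family of closed
two-sided (star-closed) ideals `dom g ⊆ A` and *-isomorphisms
`act g : dom g⁻¹ → dom g` (encoded as total maps, with all axioms stated on the domains),
such that `dom 1 = A`, `act 1 = id`, `act g` maps `dom g⁻¹ ∩ dom h` into `dom g ∩ dom (g*h)`,
and `act (g*h)` extends `act g ∘ act h`. -/
structure CStarPartialAction (G : Type*) [Group G] (A : Type*) [NonUnitalCStarAlgebra A] where
  dom : G → Set A
  act : G → A → A
  dom_isClosed : ∀ g, IsClosed (dom g)
  zero_mem : ∀ g, (0 : A) ∈ dom g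
  add_mem : ∀ g, ∀ x ∈ dom g, ∀ y ∈ dom g, x + y ∈ dom g
  smul_mem : ∀ g (c : ℂ), ∀ x ∈ dom g, c • x ∈ dom g
  mul_mem_left : ∀ g (a : A), ∀ x ∈ dom g, a * x ∈ dom g
  mul_mem_right : ∀ g (a : A), ∀ x ∈ dom g, x * a ∈ dom g
  star_mem : ∀ g, ∀ x ∈ dom g, star x ∈ dom g
  dom_one : dom 1 = Set.univ
  act_one : ∀ x, act 1 x = x
  act_mem : ∀ g, ∀ x ∈ dom g⁻¹, act g x ∈ dom g
  act_add : ∀ g, ∀ x ∈ dom g⁻¹, ∀ y ∈ dom g⁻¹, act g (x + y) = act g x + act g y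
  act_smul : ∀ g (c : ℂ), ∀ x ∈ dom g⁻¹, act g (c • x) = c • act g x
  act_mul : ∀ g, ∀ x ∈ dom g⁻¹, ∀ y ∈ dom g⁻¹, act g (x * y) = act g x * act g y
  act_star : ∀ g, ∀ x ∈ dom g⁻¹, act g (star x) = star (act g x)
  act_inv_act : ∀ g, ∀ x ∈ dom g⁻¹, act g⁻¹ (act g x) = x
  act_surjOn : ∀ g, ∀ y ∈ dom g, ∃ x ∈ dom g⁻¹, act g x = y
  act_inter_mem : ∀ g h, ∀ x ∈ dom g⁻¹ ∩ dom h, act g x ∈ dom g ∩ dom (g * h)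
  act_comp : ∀ g h, ∀ x ∈ dom h⁻¹ ∩ dom (g * h)⁻¹, act (g * h) x = act g (act h x)

/-- A positive contraction in a C*-algebra. -/
def IsPosContraction {A : Type*} [NonUnitalCStarAlgebra A] (f : A) : Prop :=
  (∃ b, f = star b * b) ∧ ‖f‖ ≤ 1

variable {G : Type*} [Group G] [Fintype G] {A : Type*} [NonUnitalCStarAlgebra A]

/-- Conditions (1)–(4) of the definition of Rokhlin dimension, for the tolerance `ε` and
finite set `F`. -/
def RokhlinTowers (α : CStarPartialAction G A) (d : ℕ) (F : Finset A) (ε : ℝ)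
    (f : G → Fin (d + 1) → A) : Prop :=
  (∀ g j, f g j ∈ α.dom g ∧ IsPosContraction (f g j)) ∧
  (∀ g h j, ∀ a ∈ F, ∀ x ∈ F, x ∈ α.dom g⁻¹ →
    ‖(α.act g (f h j * x) - f (g * h) j * α.act g x) * a‖ < ε) ∧
  (∀ j, ∀ g h : G, g ≠ h → ∀ a ∈ F, ‖f g j * f h j * a‖ < ε) ∧
  (∀ a ∈ F, ‖(∑ j : Fin (d + 1), ∑ g : G, f g j) * a - a‖ < ε) ∧
  (∀ g j, ∀ a ∈ F, ∀ b ∈ F, ‖(f g j * b - b * f g j) * a‖ < ε)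

/-- Condition (5): approximately commuting towers. -/
def CommutingTowers (d : ℕ) (F : Finset A) (ε : ℝ) (f : G → Fin (d + 1) → A) : Prop :=
  ∀ g h : G, ∀ j k : Fin (d + 1), ∀ a ∈ F, ‖(f g j * f h k - f h k * f g j) * a‖ < ε

/-- `α` has Rokhlin dimension at most `d`. -/
def HasRokhlinDimLE (α : CStarPartialAction G A) (d : ℕ) : Prop :=
  ∀ ε > (0 : ℝ), ∀ F : Finset A, ∃ f : G → Fin (d + 1) → A, RokhlinTowers α d F ε f

/-- `α` has Rokhlin dimension with commuting towers at most `d`. -/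
def HasRokhlinDimCLE (α : CStarPartialAction G A) (d : ℕ) : Prop :=
  ∀ ε > (0 : ℝ), ∀ F : Finset A, ∃ f : G → Fin (d + 1) → A,
    RokhlinTowers α d F ε f ∧ CommutingTowers d F ε f

/-- The Rokhlin dimension of `α`, as an extended natural number. -/
noncomputable def rokhlinDim (α : CStarPartialAction G A) : ℕ∞ :=
  sInf {n : ℕ∞ | ∃ d : ℕ, n = d ∧ HasRokhlinDimLE α d}

/-- The Rokhlin dimension with commuting towers of `α`. -/
noncomputable def rokhlinDimC (α : CStarPartialAction G A) : ℕ∞ :=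
  sInf {n : ℕ∞ | ∃ d : ℕ, n = d ∧ HasRokhlinDimCLE α d}

/-- The configuration of Example 3.2: a globalizable partial action `α` of `ℤ/2ℤ` on a
commutative C*-algebra `A` with globalization `(B, β)` (encoded as the partial action `βp`
with full domains, together with the equivariant embedding `ι`), such that
`dim_Rok(β) = 0` while `dim_Rok(α) > 0`. -/
structure GlobalizationDimGapExample where
  /-- The coefficient algebra (in Example 3.2, `C₀(S¹∖{1}) ⊕ C₀(S¹∖{1})`). -/
  A : Type
  /-- The algebra of the globalization (in Example 3.2, `C(S¹) ⊕ C(S¹)`). -/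
  B : Type
  [instA : NonUnitalCommCStarAlgebra A]
  [instB : NonUnitalCStarAlgebra B]
  /-- The partial action of `ℤ/2ℤ` on `A`. -/
  α : CStarPartialAction (Multiplicative (ZMod 2)) A
  /-- The globalization, as a partial action with full domains (i.e. a global action). -/
  βp : CStarPartialAction (Multiplicative (ZMod 2)) B
  hβglobal : ∀ g, βp.dom g = Set.univ
  /-- The equivariant embedding `A → B` of the globalization. -/
  ι : A → B
  hιadd : ∀ x y, ι (x + y) = ι x + ι y
  hιsmul : ∀ (c : ℂ) x, ι (c • x) = c • ι x
  hιmul : ∀ x y, ι (x * y) = ι x * ι y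
  hιstar : ∀ x, ι (star x) = star (ι x)
  hιinj : Function.Injective ι
  hιclosed : IsClosed (Set.range ι)
  hιideal : ∀ (b : B), ∀ a ∈ Set.range ι, b * a ∈ Set.range ι ∧ a * b ∈ Set.range ι
  hdom : ∀ g, ι '' α.dom g = Set.range ι ∩ βp.act g '' Set.range ι
  hact : ∀ g, ∀ x ∈ α.dom g⁻¹, ι (α.act g x) = βp.act g (ι x)
  hspan : Dense (Submodule.span ℂ
    (⋃ g : Multiplicative (ZMod 2), βp.act g '' Set.range ι) : Set B)
  /-- The globalization has Rokhlin dimension zero … -/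
  hβdim : rokhlinDim βp = 0
  /-- … but the partial action does not. -/
  hαdim : 0 < rokhlinDim α

section RestrictedAction

variable {Γ : Type*} [Group Γ]

/-- A global action by `*`-automorphisms, viewed as a partial action with full domains. -/
def globalAction {B : Type*} [NonUnitalCStarAlgebra B]
    (β : Γ →* (B ≃⋆ₐ[ℂ] B)) : CStarPartialAction Γ B where
  dom _ := Set.univ
  act g := β g
  dom_isClosed _ := isClosed_univ
  zero_mem _ := trivial
  add_mem _ _ _ _ _ := trivial
  smul_mem _ _ _ _ := trivial
  mul_mem_left _ _ _ _ := trivial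
  mul_mem_right _ _ _ _ := trivial
  star_mem _ _ _ := trivial
  dom_one := rfl
  act_one x := by simp
  act_mem _ _ _ := trivial
  act_add g x _ y _ := map_add (β g) x y
  act_smul g c x _ := map_smul (β g) c x
  act_mul g x _ y _ := map_mul (β g) x y
  act_star g x _ := map_star (β g) x
  act_inv_act g x _ := by simp [← StarAlgEquiv.mul_apply]
  act_surjOn g y _ := ⟨(β g).symm y, trivial, (β g).apply_symm_apply y⟩
  act_inter_mem _ _ _ _ := ⟨trivial, trivial⟩
  act_comp g h x _ := by simp

open Classical in
/-- The restriction of a global action by `*`-automorphisms to a closed ideal `S`. -/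
noncomputable def restrictedAction {B : Type*} [NonUnitalCommCStarAlgebra B]
    (β : Γ →* (B ≃⋆ₐ[ℂ] B)) (S : NonUnitalStarSubalgebra ℂ B) [IsClosed (S : Set B)]
    (hS : ∀ b, ∀ a ∈ S, b * a ∈ S) : CStarPartialAction Γ S where
  dom g := {x | β g⁻¹ x ∈ S}
  act g x := if h : β g x ∈ S then ⟨β g x, h⟩ else 0
  dom_isClosed g := by
    have hc : Continuous (β g⁻¹) :=
      (NonUnitalStarAlgHom.isometry (β g⁻¹) (β g⁻¹).injective).continuous
    exact ‹IsClosed (S : Set B)›.preimage (hc.comp continuous_subtype_val)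
  zero_mem g := by simp
  add_mem g x hx y hy := by
    have hx' : β g⁻¹ x ∈ S := hx
    simpa using add_mem hx' hy
  smul_mem g c x hx := by
    have hx' : β g⁻¹ x ∈ S := hx
    simpa using SMulMemClass.smul_mem c hx'
  mul_mem_left g a x hx := by simpa using hS (β g⁻¹ a) _ hx
  mul_mem_right g a x hx := by simpa [mul_comm] using hS (β g⁻¹ a) _ hx
  star_mem g x hx := by simpa [map_star] using StarMemClass.star_mem (s := S) hx
  dom_one := by ext; simp
  act_one x := by simp
  act_mem g x hx := by
    replace hx : β g x ∈ S := by simpa using hx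
    simp [hx, ← StarAlgEquiv.mul_apply]
  act_add g x hx y hy := by
    replace hx : β g x ∈ S := by simpa using hx
    replace hy : β g y ∈ S := by simpa using hy
    have hxy := add_mem hx hy
    ext; simp [hx, hy, hxy]
  act_smul g c x hx := by
    replace hx : β g x ∈ S := by simpa using hx
    have hcx := SMulMemClass.smul_mem c hx
    ext; simp [hx, hcx]
  act_mul g x hx y hy := by
    replace hx : β g x ∈ S := by simpa using hx
    replace hy : β g y ∈ S := by simpa using hy
    have hxy := mul_mem hx hy
    ext; simp [hx, hy, hxy]
  act_star g x hx := by
    replace hx : β g x ∈ S := by simpa using hx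
    have hsx := StarMemClass.star_mem hx
    ext; simp [hx, hsx, map_star]
  act_inv_act g x hx := by
    replace hx : β g x ∈ S := by simpa using hx
    ext; simp [hx, ← StarAlgEquiv.mul_apply]
  act_surjOn g y hy := by
    refine ⟨⟨β g⁻¹ y, hy⟩, ?_, ?_⟩
    · simp [← StarAlgEquiv.mul_apply]
    · ext; simp [← StarAlgEquiv.mul_apply]
  act_inter_mem g h x hx := by
    obtain ⟨hx, hxh⟩ := hx
    replace hx : β g x ∈ S := by simpa using hx
    replace hxh : (β h)⁻¹ x ∈ S := by simpa using hxh
    simp [hx, hxh, ← StarAlgEquiv.mul_apply]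
  act_comp g h x hx := by
    obtain ⟨hx, hxh⟩ := hx
    replace hx : β h x ∈ S := by simpa using hx
    replace hxh : β g (β h x) ∈ S := by simpa [← StarAlgEquiv.mul_apply, ← map_mul] using hxh
    ext; simp [hx, hxh]

theorem coe_restrictedAction_act {B : Type*} [NonUnitalCommCStarAlgebra B]
    (β : Γ →* (B ≃⋆ₐ[ℂ] B)) (S : NonUnitalStarSubalgebra ℂ B) [IsClosed (S : Set B)]
    (hS : ∀ b, ∀ a ∈ S, b * a ∈ S) {g : Γ} {x : S} (hx : β g x ∈ S) :
    ((restrictedAction β S hS).act g x : B) = β g x := by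
  simp [restrictedAction, hx]

theorem mem_restrictedAction_dom {B : Type*} [NonUnitalCommCStarAlgebra B]
    (β : Γ →* (B ≃⋆ₐ[ℂ] B)) (S : NonUnitalStarSubalgebra ℂ B) [IsClosed (S : Set B)]
    (hS : ∀ b, ∀ a ∈ S, b * a ∈ S) {g : Γ} {x : S} :
    x ∈ (restrictedAction β S hS).dom g ↔ β g⁻¹ x ∈ S :=
  Iff.rfl

end RestrictedAction

section Translation

/-- The action of a group on `C`-valued functions on it by left translation. -/
def translation (Γ C : Type*) [Group Γ] [Semiring C] [StarRing C] [Module ℂ C] :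
    Γ →* ((Γ → C) ≃⋆ₐ[ℂ] (Γ → C)) where
  toFun g :=
    { toFun := fun f h => f (g⁻¹ * h)
      invFun := fun f h => f (g * h)
      left_inv := fun f => by ext; simp
      right_inv := fun f => by ext; simp
      map_mul' := fun _ _ => rfl
      map_add' := fun _ _ => rfl
      map_star' := fun _ => rfl
      map_smul' := fun _ _ => rfl }
  map_one' := by ext; simp
  map_mul' g h := by ext; simp [mul_assoc]

@[simp]
theorem translation_apply {Γ C : Type*} [Group Γ] [Semiring C] [StarRing C] [Module ℂ C]
    (g : Γ) (f : Γ → C) (h : Γ) : translation Γ C g f h = f (g⁻¹ * h) :=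
  rfl

theorem hasRokhlinDimLE_translation (Γ C : Type*) [Group Γ] [Fintype Γ] [CommCStarAlgebra C] :
    HasRokhlinDimLE (globalAction (translation Γ C)) 0 := by
  classical
  intro ε hε F
  refine ⟨fun g _ => Pi.single g 1, fun g j => ⟨trivial, ⟨Pi.single g 1, ?_⟩, ?_⟩,
    fun g h j a _ x _ _ => ?_, fun j g h hgh a _ => ?_, fun a _ => ?_, fun g j a _ b _ => ?_⟩
  · ext k
    by_cases hk : k = g
    · subst hk; simp
    · simp [hk]
  · rw [pi_norm_le_iff_of_nonneg zero_le_one]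
    intro k
    by_cases hk : k = g
    · subst hk
      nontriviality C
      simp
    · simp [hk]
  · suffices (globalAction (translation Γ C)).act g (Pi.single h 1 * x) =
        Pi.single (g * h) 1 * (globalAction (translation Γ C)).act g x by simpa [this] using hε
    ext k
    change (Pi.single h 1 : Γ → C) (g⁻¹ * k) * x (g⁻¹ * k) =
      (Pi.single (g * h) 1 : Γ → C) k * x (g⁻¹ * k)
    simp [Pi.single_apply, inv_mul_eq_iff_eq_mul]
  · have : (Pi.single g 1 * Pi.single h 1 : Γ → C) = 0 := by
      ext k
      by_cases hk : k = g
      · subst hk; simp [hgh]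
      · simp [hk]
    simpa [this] using hε
  · have : ∑ g : Γ, (Pi.single g 1 : Γ → C) = 1 := Finset.univ_sum_single 1
    simpa [this] using hε
  · simpa [mul_comm] using hε

/-- The functions on `Γ × X` vanishing at the points `(g, p g)`. -/
def vanishingIdeal {Γ X : Type*} [TopologicalSpace X] (p : Γ → X) :
    NonUnitalStarSubalgebra ℂ (Γ → C(X, ℂ)) where
  carrier := {f | ∀ g, f g (p g) = 0}
  zero_mem' _ := rfl
  add_mem' hf hf' g := by simp [hf g, hf' g]
  mul_mem' hf _ g := by simp [hf g]
  smul_mem' c f hf g := by simp [hf g]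
  star_mem' hf g := by simp [hf g]

theorem mem_vanishingIdeal {Γ X : Type*} [TopologicalSpace X] {p : Γ → X} {f : Γ → C(X, ℂ)} :
    f ∈ vanishingIdeal p ↔ ∀ g, f g (p g) = 0 :=
  Iff.rfl

instance isClosed_vanishingIdeal {Γ X : Type*} [TopologicalSpace X] (p : Γ → X) :
    IsClosed (vanishingIdeal p : Set (Γ → C(X, ℂ))) := by
  have : (vanishingIdeal p : Set (Γ → C(X, ℂ))) = ⋂ g, {f | f g (p g) = 0} := by
    ext; simp [mem_vanishingIdeal]
  rw [this]
  exact isClosed_iInter fun g => isClosed_eq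
    ((continuous_eval_const (p g)).comp (continuous_apply g)) continuous_const

theorem mul_mem_vanishingIdeal {Γ X : Type*} [TopologicalSpace X] (p : Γ → X)
    (b a : Γ → C(X, ℂ)) (ha : a ∈ vanishingIdeal p) : b * a ∈ vanishingIdeal p :=
  fun g => by simp [ha g]

end Translation

theorem IsPosContraction.eq_norm_apply {Γ X : Type*} [Fintype Γ] [TopologicalSpace X]
    [CompactSpace X] {p : Γ → X} {f : vanishingIdeal p} (hf : IsPosContraction f)
    (g : Γ) (t : X) : (f : Γ → C(X, ℂ)) g t = (‖(f : Γ → C(X, ℂ)) g t‖ : ℂ) := by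
  obtain ⟨⟨b, rfl⟩, -⟩ := hf
  change star ((b : Γ → C(X, ℂ)) g t) * (b : Γ → C(X, ℂ)) g t =
    (‖star ((b : Γ → C(X, ℂ)) g t) * (b : Γ → C(X, ℂ)) g t‖ : ℂ)
  rw [CStarRing.norm_star_mul_self, ← sq, Complex.ofReal_pow, Complex.star_def, Complex.conj_mul']

theorem norm_apply_apply_le {Γ X : Type*} [Fintype Γ] [TopologicalSpace X]
    [CompactSpace X] (f : Γ → C(X, ℂ)) (g : Γ) (t : X) : ‖f g t‖ ≤ ‖f‖ :=
  ((f g).norm_coe_le_norm t).trans (norm_le_pi_norm f g)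

/-- If `u` and `v` are almost a partition of unity into orthogonal projections on a preconnected
set, and `v` vanishes somewhere on it, then `u` is large throughout. -/
theorem half_lt_of_almost_partition {X : Type*} [TopologicalSpace X] {s : Set X}
    (hs : IsPreconnected s) {u v : X → ℝ} (hu : Continuous u)
    (hadd : ∀ t ∈ s, |u t + v t - 1| ≤ 1 / 50) (hmul : ∀ t ∈ s, u t * v t ≤ 1 / 50)
    {x y : X} (hx : x ∈ s) (hy : y ∈ s) (hvx : v x = 0) : 1 / 2 < u y := by
  by_contra! h
  have hux := abs_le.1 (hadd x hx)
  obtain ⟨t, ht, hut⟩ := hs.intermediate_value hy hx hu.continuousOn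
    (show (1 / 2 : ℝ) ∈ Set.Icc (u y) (u x) from ⟨h, by linarith⟩)
  have h1 := abs_le.1 (hadd t ht)
  have h2 := hmul t ht
  rw [hut] at h1 h2
  linarith

section Interval

/-- The nontrivial element of `ℤ/2ℤ`. -/
abbrev flip₂ : Multiplicative (ZMod 2) := Multiplicative.ofAdd 1

theorem eq_one_or_eq_flip₂ : ∀ g : Multiplicative (ZMod 2), g = 1 ∨ g = flip₂ := by decide

theorem flip₂_ne_one : flip₂ ≠ 1 := by decide

theorem flip₂_mul_self : flip₂ * flip₂ = 1 := by decide

theorem flip₂_inv : flip₂⁻¹ = flip₂ := by decide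

/-- The endpoint removed from each of the two copies of the interval. -/
def removedPoint (g : Multiplicative (ZMod 2)) : unitInterval := if g = 1 then 1 else 0

@[simp] theorem removedPoint_one : removedPoint 1 = 1 := by simp [removedPoint]

@[simp] theorem removedPoint_flip₂ : removedPoint flip₂ = 0 := by
  simp [removedPoint]

/-- The distance to the removed endpoint. -/
def distRemoved (g : Multiplicative (ZMod 2)) : C(unitInterval, ℂ) :=
  if g = 1 then ⟨fun t => ((1 - t : ℝ) : ℂ), by fun_prop⟩ else ⟨fun t => ((t : ℝ) : ℂ), by fun_prop⟩

@[simp] theorem distRemoved_one_apply (t : unitInterval) :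
    distRemoved 1 t = ((1 - t : ℝ) : ℂ) := by simp [distRemoved]

@[simp] theorem distRemoved_flip₂_apply (t : unitInterval) :
    distRemoved flip₂ t = ((t : ℝ) : ℂ) := by simp [distRemoved]

theorem mem_vanishingIdeal_removedPoint {f : Multiplicative (ZMod 2) → C(unitInterval, ℂ)} :
    f ∈ vanishingIdeal removedPoint ↔ f 1 1 = 0 ∧ f flip₂ 0 = 0 := by
  rw [mem_vanishingIdeal]
  constructor
  · intro h
    simpa using And.intro (h 1) (h flip₂)
  · rintro ⟨h1, h2⟩ g
    obtain rfl | rfl := eq_one_or_eq_flip₂ g <;> simpa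

theorem distRemoved_mem : distRemoved ∈ vanishingIdeal removedPoint := by
  simp [mem_vanishingIdeal_removedPoint]

/-- The swap of the two copies of the interval, restricted to the half-open copies. -/
noncomputable abbrev partialSwap :
    CStarPartialAction (Multiplicative (ZMod 2)) (vanishingIdeal removedPoint) :=
  restrictedAction (translation _ _) _ (mul_mem_vanishingIdeal _)

theorem not_hasRokhlinDimLE_partialSwap : ¬ HasRokhlinDimLE partialSwap 0 := by
  classical
  intro H
  let a : vanishingIdeal removedPoint := ⟨distRemoved, distRemoved_mem⟩
  let b : Multiplicative (ZMod 2) → C(unitInterval, ℂ) :=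
    fun _ => distRemoved 1 * distRemoved flip₂
  have hb : b ∈ vanishingIdeal removedPoint := by simp [mem_vanishingIdeal_removedPoint, b]
  have hbσ (y) (hy : y ∈ vanishingIdeal removedPoint) :
      translation _ _ flip₂ (y * b) ∈ vanishingIdeal removedPoint := by
    simp [mem_vanishingIdeal_removedPoint, b]
  obtain ⟨f, hf, hequiv, horth, hsum, -⟩ := H (1 / 100) (by norm_num) {a, ⟨b, hb⟩}
  let u (g k : Multiplicative (ZMod 2)) (t : unitInterval) : ℝ :=
    ‖(f g 0 : Multiplicative (ZMod 2) → C(unitInterval, ℂ)) k t‖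
  have hu (g k t) : (f g 0 : Multiplicative (ZMod 2) → C(unitInterval, ℂ)) k t = (u g k t : ℂ) :=
    (hf g 0).2.eq_norm_apply k t
  have hu0 (g k t) : 0 ≤ u g k t := norm_nonneg _
  have huc (g k) : Continuous (u g k) := by fun_prop
  let d (k : Multiplicative (ZMod 2)) (t : unitInterval) : ℝ := ‖distRemoved k t‖
  have hd1 (t : unitInterval) : d 1 t = 1 - t := by
    simp only [d, distRemoved_one_apply, Complex.norm_real, Real.norm_eq_abs]
    exact abs_of_nonneg (sub_nonneg.2 t.2.2)
  have hd2 (t : unitInterval) : d flip₂ t = t := by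
    simp only [d, distRemoved_flip₂_apply, Complex.norm_real, Real.norm_eq_abs]
    exact abs_of_nonneg t.2.1
  have hmul (k t) : u 1 k t * u flip₂ k t * d k t ≤ 1 / 100 := by
    have h := (norm_apply_apply_le _ k t).trans (horth 0 1 flip₂ flip₂_ne_one.symm a (by simp)).le
    change ‖(f 1 0 : Multiplicative (ZMod 2) → C(unitInterval, ℂ)) k t *
      (f flip₂ 0 : Multiplicative (ZMod 2) → C(unitInterval, ℂ)) k t * distRemoved k t‖ ≤ _ at h
    simpa only [norm_mul] using h
  have hadd (k t) : |u 1 k t + u flip₂ k t - 1| * d k t ≤ 1 / 100 := by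
    have h := hsum a (by simp)
    rw [Fin.sum_univ_one, show (Finset.univ : Finset (Multiplicative (ZMod 2))) = {1, flip₂} by
      decide, Finset.sum_pair flip₂_ne_one.symm] at h
    replace h := (norm_apply_apply_le _ k t).trans h.le
    change ‖((f 1 0 : Multiplicative (ZMod 2) → C(unitInterval, ℂ)) k t +
      (f flip₂ 0 : Multiplicative (ZMod 2) → C(unitInterval, ℂ)) k t) * distRemoved k t -
      distRemoved k t‖ ≤ _ at h
    rw [hu, hu, ← sub_one_mul, norm_mul] at h
    rwa [← Complex.ofReal_add, ← Complex.ofReal_one, ← Complex.ofReal_sub, Complex.norm_real,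
      Real.norm_eq_abs] at h
  have heq (k t) : |u 1 (flip₂ * k) t - u flip₂ k t| * (d 1 t * d flip₂ t) * d k t ≤ 1 / 100 := by
    have hbσ' : translation _ _ flip₂ b ∈ vanishingIdeal removedPoint := by
      simp [mem_vanishingIdeal_removedPoint, b]
    have h := hequiv flip₂ 1 0 a (by simp) ⟨b, hb⟩ (by simp) (by
      rw [mem_restrictedAction_dom, inv_inv]
      exact hbσ')
    replace h := (norm_apply_apply_le _ k t).trans h.le
    change ‖((partialSwap.act flip₂ (f 1 0 * ⟨b, hb⟩) :
        Multiplicative (ZMod 2) → C(unitInterval, ℂ)) k t -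
      (f flip₂ 0 : Multiplicative (ZMod 2) → C(unitInterval, ℂ)) k t *
      (partialSwap.act flip₂ ⟨b, hb⟩ : Multiplicative (ZMod 2) → C(unitInterval, ℂ)) k t) *
      distRemoved k t‖ ≤ _ at h
    rw [coe_restrictedAction_act _ _ _ (hbσ _ (f 1 0).2),
      coe_restrictedAction_act _ _ _ hbσ'] at h
    change ‖((f 1 0 : Multiplicative (ZMod 2) → C(unitInterval, ℂ)) (flip₂⁻¹ * k) t *
      (distRemoved 1 t * distRemoved flip₂ t) -
      (f flip₂ 0 : Multiplicative (ZMod 2) → C(unitInterval, ℂ)) k t *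
      (distRemoved 1 t * distRemoved flip₂ t)) * distRemoved k t‖ ≤ _ at h
    rw [hu, hu, ← sub_mul, norm_mul, norm_mul, norm_mul, flip₂_inv] at h
    rwa [← Complex.ofReal_sub, Complex.norm_real, Real.norm_eq_abs] at h
  have hvanish : u flip₂ 1 0 = 0 ∧ u flip₂ flip₂ 1 = 0 := by
    have h := mem_vanishingIdeal_removedPoint.1 ((mem_restrictedAction_dom _ _ _).1 (hf flip₂ 0).1)
    simp only [translation_apply, inv_inv, mul_one, flip₂_mul_self] at h
    exact ⟨norm_eq_zero.2 h.2, norm_eq_zero.2 h.1⟩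
  have hlarge (k) {s : Set unitInterval} (hs : IsPreconnected s) (hsd : ∀ t ∈ s, 1 / 2 ≤ d k t)
      {x y : unitInterval} (hx : x ∈ s) (hy : y ∈ s) (h0 : u flip₂ k x = 0) : 1 / 2 < u 1 k y := by
    refine half_lt_of_almost_partition hs (huc 1 k) (v := u flip₂ k) (fun t ht => ?_)
      (fun t ht => ?_) hx hy h0
    · nlinarith [hadd k t, hsd t ht, abs_nonneg (u 1 k t + u flip₂ k t - 1)]
    · nlinarith [hmul k t, hsd t ht, mul_nonneg (hu0 1 k t) (hu0 flip₂ k t)]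
  let m : unitInterval := ⟨1 / 2, by norm_num, by norm_num⟩
  have hm : (m : ℝ) = 1 / 2 := rfl
  have h1 : 1 / 2 < u 1 1 m := by
    refine hlarge 1 (isPreconnected_Iic (a := m)) (fun t ht => ?_) (x := 0)
      (Set.mem_Iic.2 bot_le) (Set.mem_Iic.2 le_rfl) hvanish.1
    have : (t : ℝ) ≤ 1 / 2 := ht
    rw [hd1]
    linarith
  have h2 : 1 / 2 < u 1 flip₂ m := by
    refine hlarge flip₂ (isPreconnected_Ici (a := m)) (fun t ht => ?_) (x := 1)
      (Set.mem_Ici.2 le_top) (Set.mem_Ici.2 le_rfl) hvanish.2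
    have : 1 / 2 ≤ (t : ℝ) := ht
    rw [hd2]
    linarith
  have h3 := heq 1 m
  have h4 := hmul 1 m
  rw [mul_one, hd1, hd2, hm] at h3
  rw [hd1, hm] at h4
  have h5 := neg_abs_le (u 1 flip₂ m - u flip₂ 1 m)
  have h6 := le_abs_self (u 1 flip₂ m - u flip₂ 1 m)
  nlinarith

/-- Every function is the sum of one in the ideal and a translate of one in the ideal. -/
theorem mem_span_translates_vanishingIdeal (f : Multiplicative (ZMod 2) → C(unitInterval, ℂ)) :
    f ∈ Submodule.span ℂ (⋃ g : Multiplicative (ZMod 2),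
      translation _ C(unitInterval, ℂ) g '' vanishingIdeal removedPoint) := by
  have h : f = distRemoved * f +
      translation _ _ flip₂ (distRemoved * translation _ _ flip₂ f) := by
    ext k t
    obtain rfl | rfl := eq_one_or_eq_flip₂ k
    · simp [flip₂_inv, flip₂_mul_self]
      ring
    · simp [flip₂_inv, flip₂_mul_self]
      ring
  rw [h]
  refine add_mem (Submodule.subset_span (Set.mem_iUnion.2 ⟨1, distRemoved * f, ?_, by simp⟩))
    (Submodule.subset_span (Set.mem_iUnion.2 ⟨flip₂, _, ?_, rfl⟩))
  · rw [mul_comm]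
    exact mul_mem_vanishingIdeal _ _ _ distRemoved_mem
  · rw [mul_comm]
    exact mul_mem_vanishingIdeal _ _ _ distRemoved_mem

end Interval

/-- There is a globalizable partial action of `ℤ/2ℤ` on a commutative
C*-algebra whose globalization has Rokhlin dimension `0`, while the partial action itself
has Rokhlin dimension `> 0`. -/
theorem exists_globalization_dim_gap : Nonempty GlobalizationDimGapExample := by
  have hr : Set.range (Subtype.val : vanishingIdeal removedPoint → _) =
      vanishingIdeal removedPoint := Subtype.range_coe
  exact ⟨{
    A := vanishingIdeal removedPoint
    B := Multiplicative (ZMod 2) → C(unitInterval, ℂ)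
    α := partialSwap
    βp := globalAction (translation _ C(unitInterval, ℂ))
    hβglobal := fun _ => rfl
    ι := Subtype.val
    hιadd := fun _ _ => rfl
    hιsmul := fun _ _ => rfl
    hιmul := fun _ _ => rfl
    hιstar := fun _ => rfl
    hιinj := Subtype.val_injective
    hιclosed := by
      rw [hr]
      exact isClosed_vanishingIdeal _
    hιideal := by
      rw [hr]
      exact fun b a ha => ⟨mul_mem_vanishingIdeal _ b a ha,
        mul_comm b a ▸ mul_mem_vanishingIdeal _ b a ha⟩
    hdom := fun g => by
      rw [hr]
      ext y
      constructor
      · rintro ⟨x, hx, rfl⟩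
        refine ⟨x.2, translation _ _ g⁻¹ x.1, hx, ?_⟩
        change translation _ _ g (translation _ _ g⁻¹ x.1) = x.1
        simp [← StarAlgEquiv.mul_apply]
      · rintro ⟨hy, x, hx, rfl⟩
        refine ⟨⟨_, hy⟩, ?_, rfl⟩
        rw [mem_restrictedAction_dom]
        change translation _ _ g⁻¹ (translation _ _ g x) ∈ _
        simpa [← StarAlgEquiv.mul_apply] using hx
    hact := fun g x hx => coe_restrictedAction_act _ _ _ (by
      rwa [mem_restrictedAction_dom, inv_inv] at hx)
    hspan := fun f => subset_closure (by
      rw [hr]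
      exact mem_span_translates_vanishingIdeal f)
    hβdim := ENat.sInf_eq_zero.2 ⟨0, rfl, hasRokhlinDimLE_translation _ _⟩
    hαdim := by
      rw [pos_iff_ne_zero, rokhlinDim, Ne, ENat.sInf_eq_zero]
      rintro ⟨n, hn, h⟩
      obtain rfl : n = 0 := by exact_mod_cast hn.symm
      exact not_hasRokhlinDimLE_partialSwap h }⟩
end

section
/- Let α be a partial action of a group G on a C*-algebra A, let J be an α-invariant closed two-sided ideal of A, let g ∈ G, and let q ∈ J be an element satisfying α_g(qx) = q·α_g(x) for all x ∈ A_{g⁻¹} ∩ J. Then α_g(qa) = q·α_g(a) for all a ∈ A_{g⁻¹}. -/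
/-- Let `α` be a partial action of a group `G` on a C*-algebra `A`, `J`
an `α`-invariant closed two-sided ideal, `g ∈ G`, and `q ∈ J` an element with
`α_g (q x) = q α_g (x)` for all `x ∈ A_{g⁻¹} ∩ J`.  Then `α_g (q a) = q α_g (a)` for all
`a ∈ A_{g⁻¹}`. -/
theorem act_smul_of_act_smul_on_ideal {G : Type*} [Group G]
    {A : Type*} [NonUnitalCStarAlgebra A]
    (α : CStarPartialAction G A) (J : Set A)
    (hJclosed : IsClosed J) (hJ0 : (0 : A) ∈ J)
    (hJadd : ∀ x ∈ J, ∀ y ∈ J, x + y ∈ J)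
    (hJsmul : ∀ (c : ℂ), ∀ x ∈ J, c • x ∈ J)
    (hJmull : ∀ (a : A), ∀ x ∈ J, a * x ∈ J)
    (hJmulr : ∀ (a : A), ∀ x ∈ J, x * a ∈ J)
    (hJstar : ∀ x ∈ J, star x ∈ J)
    (hJinv : ∀ h : G, ∀ x ∈ J ∩ α.dom h⁻¹, α.act h x ∈ J)
    (g : G) (q : A) (hq : q ∈ J)
    (hqact : ∀ x ∈ α.dom g⁻¹ ∩ J, α.act g (q * x) = q * α.act g x) :
    ∀ a ∈ α.dom g⁻¹, α.act g (q * a) = q * α.act g a := by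
  intro a ha
  have hag := α.act_mem g a ha
  have hqa : q * a ∈ α.dom g⁻¹ := α.mul_mem_left _ q a ha
  have neg_mem_of_smul_mem {S : Set A} (hS : ∀ (c : ℂ), ∀ x ∈ S, c • x ∈ S) {x : A}
      (hx : x ∈ S) : -x ∈ S := by
    simpa using hS (-1) x hx
  -- The difference `u` of the two sides lies in `J ∩ α.dom g`, and annihilates that ideal.
  set u := α.act g (q * a) - q * α.act g a with hu
  have huJ : u ∈ J := by
    rw [hu, sub_eq_add_neg]
    exact hJadd _ (hJinv g _ ⟨hJmulr a q hq, hqa⟩) _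
      (neg_mem_of_smul_mem hJsmul (hJmulr _ q hq))
  have hug : u ∈ α.dom g := by
    rw [hu, sub_eq_add_neg]
    exact α.add_mem g _ (α.act_mem g _ hqa) _
      (neg_mem_of_smul_mem (α.smul_mem g) (α.mul_mem_left g q _ hag))
  obtain ⟨z, hz, hzu⟩ := α.act_surjOn g (star u) (α.star_mem g u hug)
  have hzJ : z ∈ J := by
    rw [← α.act_inv_act g z hz, hzu]
    exact hJinv g⁻¹ _ ⟨hJstar u huJ, by simpa using α.star_mem g u hug⟩
  have huu : u * star u = 0 := by
    rw [← hzu, hu, sub_mul, ← α.act_mul g _ hqa z hz, mul_assoc, mul_assoc,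
      hqact (a * z) ⟨α.mul_mem_left _ a z hz, hJmull a z hzJ⟩, α.act_mul g a ha z hz, sub_self]
  exact sub_eq_zero.mp ((CStarRing.mul_star_self_eq_zero_iff u).mp huu)
end

section
/- Let X be a locally compact Hausdorff space, let G be a finite group, let θ be a topological partial action of G on X, and let α denote the induced partial action of G on C₀(X). If dim_Rok(α) < ∞ (i.e., α has Rokhlin dimension at most d for some d ∈ ℕ), then θ is free. -/
variable {G : Type*} [Group G] [Fintype G] {A : Type*} [NonUnitalCStarAlgebra A]

/-- A topological partial action of a group `G` on a space `X`: open sets `dom g` and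
homeomorphisms `act g : dom g⁻¹ → dom g` (encoded as total maps with all axioms stated on
the domains) with `dom 1 = X`, `act 1 = id`, and `act (g*h)` extending `act g ∘ act h`. -/
structure TopPartialAction (G : Type*) [Group G] (X : Type*) [TopologicalSpace X] where
  dom : G → Set X
  act : G → X → X
  dom_isOpen : ∀ g, IsOpen (dom g)
  dom_one : dom 1 = Set.univ
  act_one : ∀ x, act 1 x = x
  act_mem : ∀ g, ∀ x ∈ dom g⁻¹, act g x ∈ dom g
  act_continuousOn : ∀ g, ContinuousOn (act g) (dom g⁻¹)
  act_inv_act : ∀ g, ∀ x ∈ dom g⁻¹, act g⁻¹ (act g x) = x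
  act_surjOn : ∀ g, ∀ y ∈ dom g, ∃ x ∈ dom g⁻¹, act g x = y
  act_comp : ∀ g h, ∀ x ∈ dom h⁻¹, act h x ∈ dom g⁻¹ →
    x ∈ dom (g * h)⁻¹ ∧ act (g * h) x = act g (act h x)

/-- Freeness of a topological partial action. -/
def TopPartialAction.Free {G : Type*} [Group G] {X : Type*} [TopologicalSpace X]
    (θ : TopPartialAction G X) : Prop :=
  ∀ g : G, g ≠ 1 → ∀ x ∈ θ.dom g⁻¹, θ.act g x ≠ x

open scoped ZeroAtInfty

/-- In a locally compact Hausdorff space, every point of an open set `U` admits a function in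
`C₀(X, ℂ)` taking the value `1` at the point and vanishing outside `U`. -/
theorem ZeroAtInftyContinuousMap.exists_eq_one_of_mem_isOpen {X : Type*} [TopologicalSpace X]
    [LocallyCompactSpace X] [T2Space X] {U : Set X} (hU : IsOpen U) {x : X} (hx : x ∈ U) :
    ∃ u : C₀(X, ℂ), u x = 1 ∧ ∀ y ∉ U, u y = 0 := by
  obtain ⟨f, hf1, hf0, hfc, -⟩ := exists_continuous_one_zero_of_isCompact
    (isCompact_singleton (x := x)) hU.isClosed_compl
    (Set.disjoint_singleton_left.mpr fun h => h hx)
  have hc : HasCompactSupport fun y => (f y : ℂ) := hfc.comp_left Complex.ofReal_zero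
  refine ⟨⟨⟨fun y => (f y : ℂ), by fun_prop⟩, hc.is_zero_at_infty⟩, ?_, fun y hy => ?_⟩
  · have h : f x = 1 := hf1 rfl
    simp [h]
  · have h : f y = 0 := hf0 hy
    simp [h]

theorem ZeroAtInftyContinuousMap.norm_apply_le {X E : Type*} [TopologicalSpace X]
    [SeminormedAddCommGroup E] (f : C₀(X, E)) (x : X) : ‖f x‖ ≤ ‖f‖ :=
  f.toBCF.norm_coe_le_norm x

theorem ZeroAtInftyContinuousMap.sum_apply {ι X E : Type*} [TopologicalSpace X]
    [TopologicalSpace E] [AddCommMonoid E] [ContinuousAdd E] (s : Finset ι) (f : ι → C₀(X, E))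
    (x : X) : (∑ i ∈ s, f i) x = ∑ i ∈ s, f i x :=
  map_sum (⟨⟨fun f => f x, rfl⟩, fun _ _ => rfl⟩ : C₀(X, E) →+ E) f s

/-- A contraction `a` which is `ε`-close and `ε`-orthogonal to `b` satisfies `‖a‖² < 2ε`. -/
theorem norm_sq_lt_of_norm_sub_lt_of_norm_mul_lt {a b : ℂ} {ε : ℝ} (ha : ‖a‖ ≤ 1)
    (hsub : ‖a - b‖ < ε) (hmul : ‖a * b‖ < ε) : ‖a‖ ^ 2 < 2 * ε := by
  calc ‖a‖ ^ 2 = ‖a * (a - b) + a * b‖ := by rw [← norm_pow]; ring_nf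
    _ ≤ ‖a‖ * ‖a - b‖ + ‖a * b‖ := (norm_add_le _ _).trans_eq (by rw [norm_mul])
    _ < 2 * ε := by nlinarith [mul_le_mul_of_nonneg_right ha (norm_nonneg (a - b))]

/-- Let `θ` be a topological partial action of a finite group `G` on a
locally compact Hausdorff space `X` and let `α` be the induced partial action of `G` on
`C₀(X)` (domains `C₀(X_g)`, `α_g f = f ∘ θ_{g⁻¹}`).  If `dim_Rok(α) < ∞` then `θ` is
free. -/
theorem free_of_finite_rokhlinDim {G : Type*} [Group G] [Fintype G]
    {X : Type*} [TopologicalSpace X] [LocallyCompactSpace X] [T2Space X]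
    (θ : TopPartialAction G X) (α : CStarPartialAction G C₀(X, ℂ))
    (hdom : ∀ g, α.dom g = {f : C₀(X, ℂ) | ∀ x, x ∉ θ.dom g → f x = 0})
    (hact : ∀ g, ∀ f ∈ α.dom g⁻¹, ∀ x ∈ θ.dom g, α.act g f x = f (θ.act g⁻¹ x))
    (hfin : ∃ d : ℕ, HasRokhlinDimLE α d) :
    θ.Free := by
  classical
  intro g hg x hx hgx
  obtain ⟨d, hd⟩ := hfin
  have hxg : x ∈ θ.dom g := hgx ▸ θ.act_mem g x hx
  have hinv : θ.act g⁻¹ x = x := by simpa only [hgx] using θ.act_inv_act g x hx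
  obtain ⟨u, hux, hu0⟩ :=
    ZeroAtInftyContinuousMap.exists_eq_one_of_mem_isOpen (θ.dom_isOpen g⁻¹) hx
  have hu : u ∈ α.dom g⁻¹ := by rw [hdom]; exact hu0
  set N : ℝ := (d + 1) * Fintype.card G with hN
  have hN1 : 1 ≤ N := by
    have h : (1 : ℝ) ≤ Fintype.card G := by exact_mod_cast Fintype.card_pos
    nlinarith [(Nat.cast_nonneg d : (0 : ℝ) ≤ d)]
  have hN0 : 0 < N := by linarith
  obtain ⟨f, hf, hequiv, horth, hsum, -⟩ := hd (1 / (8 * N ^ 2)) (by positivity) {u}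
  have hle : ∀ h j, ‖f h j x‖ ≤ 1 / (2 * N) := by
    intro h j
    have hclose : ‖f h j x - f (g * h) j x‖ < 1 / (8 * N ^ 2) := by
      have key := (ZeroAtInftyContinuousMap.norm_apply_le _ x).trans_lt
        (hequiv g h j u (by simp) u (by simp) hu)
      simpa [hact g _ (α.mul_mem_left g⁻¹ (f h j) u hu) x hxg, hact g u hu x hxg, hinv, hux]
        using key
    have hmul : ‖f h j x * f (g * h) j x‖ < 1 / (8 * N ^ 2) := by
      have key := (ZeroAtInftyContinuousMap.norm_apply_le _ x).trans_lt
        (horth j h (g * h) (by simpa using hg) u (by simp))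
      simpa [hux] using key
    have hsq := norm_sq_lt_of_norm_sub_lt_of_norm_mul_lt
      ((ZeroAtInftyContinuousMap.norm_apply_le _ x).trans (hf h j).2.2) hclose hmul
    refine le_of_sq_le_sq ?_ (by positivity)
    refine hsq.le.trans_eq ?_
    field_simp
    norm_num
  have hone : ‖(∑ j : Fin (d + 1), ∑ h : G, f h j x) - 1‖ < 1 / (8 * N ^ 2) := by
    have key := (ZeroAtInftyContinuousMap.norm_apply_le _ x).trans_lt (hsum u (by simp))
    simpa [hux, ZeroAtInftyContinuousMap.sum_apply] using key
  have hhalf : ‖∑ j : Fin (d + 1), ∑ h : G, f h j x‖ ≤ 1 / 2 := by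
    calc ‖∑ j : Fin (d + 1), ∑ h : G, f h j x‖
        ≤ ∑ j : Fin (d + 1), ∑ h : G, 1 / (2 * N) :=
          norm_sum_le_of_le _ fun j _ => norm_sum_le_of_le _ fun h _ => hle h j
      _ = N * (1 / (2 * N)) := by simp [hN]; ring
      _ = 1 / 2 := by field_simp
  have heps : 1 / (8 * N ^ 2) ≤ 1 / 8 :=
    one_div_le_one_div_of_le (by norm_num) (by nlinarith)
  have htri := norm_sub_norm_le (1 : ℂ) (∑ j : Fin (d + 1), ∑ h : G, f h j x)
  rw [norm_one, norm_sub_rev] at htri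
  linarith
end
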